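/- In the Hilbert ℓ∞(ℕ)-module c₀, for every ℓ ∈ ℕ the sequence {δ_j}_{j∈ℕ, j≠ℓ} is not a frame for c₀: there is no constant C > 0 such that C‖u‖² ≤ ‖∑_{j≠ℓ} ⟨u, δ_j⟩⟨δ_j, u⟩‖_{ℓ∞} = sup_{j≠ℓ} |u_j|² for all u ∈ c₀ (indeed, for u = δ_ℓ the right-hand side is 0 while ‖u‖ = 1). Consequently {δ_j}_{j∈ℕ} is an exact frame for c₀. -/

import Mathlib

open Filter Topology ZeroAtInftyContinuousMap
open scoped ENNReal

set_option synthInstance.maxHeartbeats 1000000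
set_option maxHeartbeats 1000000

noncomputable section

/-- The C*-algebra `A = ℓ∞(ℕ, ℂ)` of bounded complex sequences, with pointwise operations. -/
abbrev Linf : Type := ↥(lp (fun _ : ℕ => ℂ) ∞)

/-- The Hilbert `ℓ∞(ℕ)`-module `H = c₀` of complex sequences vanishing at infinity,
with the supremum norm. -/
abbrev CZero : Type := ZeroAtInftyContinuousMap ℕ ℂ

/-- The standard unit vectors `δ j` of `c₀`: value `1` at the `j`-th coordinate, `0` elsewhere. -/
def delta (j : ℕ) : CZero where
  toFun i := if i = j then 1 else 0
  continuous_toFun := continuous_of_discreteTopology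
  zero_at_infty' := by
    rw [cocompact_eq_atTop]
    refine tendsto_const_nhds.congr' ?_
    filter_upwards [eventually_gt_atTop j] with i hi
    simp [hi.ne']

/-- The `ℓ∞(ℕ)`-valued inner product on `c₀`: `⟪u, v⟫ = (uᵢ · conj(vᵢ))ᵢ`. -/
def cInner (u v : CZero) : Linf :=
  ⟨fun i => u i * star (v i), memℓp_infty <| by
    refine ⟨‖u‖ * ‖v‖, ?_⟩
    rintro r ⟨i, rfl⟩
    calc ‖u i * star (v i)‖ = ‖u i‖ * ‖v i‖ := by rw [norm_mul, norm_star]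
    _ ≤ ‖u‖ * ‖v‖ := by
        gcongr
        · exact u.toBCF.norm_coe_le_norm i
        · exact v.toBCF.norm_coe_le_norm i⟩

/-- The pointwise module action of `ℓ∞(ℕ)` on `c₀`: `(a • u)ᵢ = aᵢ uᵢ`. -/
instance : SMul Linf CZero where
  smul a u :=
    { toFun := fun i => a i * u i
      continuous_toFun := continuous_of_discreteTopology
      zero_at_infty' := by
        have h0 : Tendsto (fun i => ‖a‖ * ‖u i‖) (cocompact ℕ) (𝓝 0) := by
          simpa using (zero_at_infty u).norm.const_mul ‖a‖
        refine squeeze_zero_norm (fun i => ?_) h0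
        rw [norm_mul]
        gcongr
        exact lp.norm_apply_le_norm ENNReal.top_ne_zero a i }

@[simp] lemma smul_apply' (a : Linf) (u : CZero) (i : ℕ) : (a • u) i = a i * u i := rfl

instance : Module Linf CZero where
  one_smul u := by ext i; simp [lp.infty_coeFn_one]
  mul_smul a b u := by ext i; simp [lp.infty_coeFn_mul]; ring
  smul_zero a := by ext i; simp
  smul_add a u v := by ext i; simp [mul_add]
  add_smul a b u := by ext i; simp [lp.coeFn_add, add_mul]
  zero_smul u := by ext i; simp [lp.coeFn_zero]

/-- A family in `c₀` is a frame (norm form) if the frame series converge and two-sided norm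
frame bounds hold. -/
def IsFrameC0 {ι : Type*} (x : ι → CZero) : Prop :=
  (∀ u : CZero, Summable fun j => cInner u (x j) * cInner (x j) u) ∧
  ∃ C D : ℝ, 0 < C ∧ C ≤ D ∧ ∀ u : CZero,
    C * ‖u‖ ^ 2 ≤ ‖∑' j, cInner u (x j) * cInner (x j) u‖ ∧
    ‖∑' j, cInner u (x j) * cInner (x j) u‖ ≤ D * ‖u‖ ^ 2

lemma aux_term (u : CZero) (k i : ℕ) :
    (cInner u (delta k) * cInner (delta k) u : Linf) i = if i = k then ((‖u i‖ ^ 2 : ℝ) : ℂ) else 0 := by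
  rw [lp.infty_coeFn_mul]
  change u i * star (if i = k then (1 : ℂ) else 0) * ((if i = k then (1 : ℂ) else 0) * star (u i)) = _
  split_ifs
  · simp [Complex.mul_conj, Complex.normSq_eq_norm_sq]
  · simp

lemma aux_norm_le (u : CZero) (i : ℕ) : ‖u i‖ ≤ ‖u‖ := u.toBCF.norm_coe_le_norm i

lemma aux_norm_sq_le (u : CZero) (i : ℕ) : ‖u i‖ ^ 2 ≤ ‖u‖ ^ 2 :=
  pow_le_pow_left₀ (norm_nonneg _) (aux_norm_le u i) 2

open Classical in
/-- The frame sum. -/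
def auxT (R : Set ℕ) (u : CZero) : Linf :=
  ⟨fun i => if i ∈ R then ((‖u i‖ ^ 2 : ℝ) : ℂ) else 0, memℓp_infty <| by
    refine ⟨‖u‖ ^ 2, ?_⟩
    rintro r ⟨i, rfl⟩
    dsimp only
    split_ifs
    · rw [Complex.norm_real, Real.norm_of_nonneg (by positivity)]
      exact aux_norm_sq_le u i
    · simp⟩

open Classical in
lemma auxT_apply (R : Set ℕ) (u : CZero) (i : ℕ) :
    auxT R u i = if i ∈ R then ((‖u i‖ ^ 2 : ℝ) : ℂ) else 0 := rfl

open Classical in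
lemma aux_sum {ι : Type} (f : ι → ℕ) (hf : Function.Injective f) (u : CZero) (s : Finset ι) (i : ℕ) :
    (∑ j ∈ s, cInner u (delta (f j)) * cInner (delta (f j)) u : Linf) i
      = if i ∈ s.image f then ((‖u i‖ ^ 2 : ℝ) : ℂ) else 0 := by
  rw [lp.coeFn_sum, Finset.sum_apply]
  simp_rw [aux_term]
  rw [← Finset.sum_image (s := s) (g := f) (f := fun k => if i = k then ((‖u i‖ ^ 2 : ℝ) : ℂ) else 0)
    hf.injOn]
  rw [Finset.sum_ite_eq]

lemma aux_hasSum {ι : Type} (f : ι → ℕ) (hf : Function.Injective f) (u : CZero) :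
    HasSum (fun j => cInner u (delta (f j)) * cInner (delta (f j)) u) (auxT (Set.range f) u) := by
  classical
  rw [HasSum, SummationFilter.unconditional_filter, Metric.tendsto_atTop]
  intro ε hε
  have h0 : Tendsto (fun i => ‖u i‖ ^ 2) atTop (𝓝 0) := by
    have := (zero_at_infty u).norm.pow 2
    rw [cocompact_eq_atTop] at this
    simpa using this
  obtain ⟨N, hN⟩ := eventually_atTop.1 (h0.eventually (gt_mem_nhds (half_pos hε)))
  have hfin : (f ⁻¹' (Set.Iio N)).Finite := (Set.finite_Iio N).preimage hf.injOn
  refine ⟨hfin.toFinset, fun s hs => ?_⟩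
  rw [dist_eq_norm]
  refine lt_of_le_of_lt ?_ (half_lt_self hε)
  refine lp.norm_le_of_forall_le (half_pos hε).le fun i => ?_
  rw [lp.coeFn_sub, Pi.sub_apply, aux_sum f hf, auxT_apply]
  by_cases h1 : i ∈ s.image f
  · have h2 : i ∈ Set.range f := by
      obtain ⟨j, _, rfl⟩ := Finset.mem_image.1 h1
      exact ⟨j, rfl⟩
    rw [if_pos h1, if_pos h2, sub_self, norm_zero]
    exact (half_pos hε).le
  · rw [if_neg h1, zero_sub, norm_neg]
    split_ifs with h2
    · obtain ⟨j, rfl⟩ := h2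
      rw [Complex.norm_real, Real.norm_of_nonneg (by positivity)]
      refine (hN _ ?_).le
      by_contra h3
      exact h1 (Finset.mem_image_of_mem f (hs (by simpa using h3)))
    · simpa using (half_pos hε).le

lemma aux_norm {ι : Type} (f : ι → ℕ) (u : CZero) :
    ‖auxT (Set.range f) u‖ = ⨆ j, ‖u (f j)‖ ^ 2 := by
  have hb : BddAbove (Set.range fun j => ‖u (f j)‖ ^ 2) := by
    refine ⟨‖u‖ ^ 2, ?_⟩
    rintro _ ⟨j, rfl⟩
    exact aux_norm_sq_le u _
  apply le_antisymm
  · have hn : 0 ≤ ⨆ j, ‖u (f j)‖ ^ 2 := Real.iSup_nonneg fun j => by positivity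
    refine lp.norm_le_of_forall_le hn fun i => ?_
    rw [auxT_apply]
    split_ifs with h
    · obtain ⟨j, rfl⟩ := h
      rw [Complex.norm_real, Real.norm_of_nonneg (by positivity)]
      exact le_ciSup hb j
    · simpa using hn
  · refine Real.iSup_le (fun j => ?_) (norm_nonneg _)
    have := lp.norm_apply_le_norm ENNReal.top_ne_zero (auxT (Set.range f) u) (f j)
    rw [auxT_apply, if_pos ⟨j, rfl⟩, Complex.norm_real, Real.norm_of_nonneg (by positivity)] at this
    exact this

lemma aux_main {ι : Type} (f : ι → ℕ) (hf : Function.Injective f) (u : CZero) :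
    ‖∑' j, cInner u (delta (f j)) * cInner (delta (f j)) u‖ = ⨆ j, ‖u (f j)‖ ^ 2 := by
  rw [(aux_hasSum f hf u).tsum_eq, aux_norm]

lemma aux_delta (k i : ℕ) : delta k i = if i = k then 1 else 0 := rfl

lemma aux_czero_norm_le (u : CZero) {M : ℝ} (hM : 0 ≤ M) (h : ∀ i, ‖u i‖ ≤ M) : ‖u‖ ≤ M :=
  (BoundedContinuousFunction.norm_le (f := u.toBCF) hM).2 h

lemma aux_delta_norm (k : ℕ) : ‖delta k‖ = 1 := by
  apply le_antisymm
  · refine aux_czero_norm_le _ zero_le_one fun i => ?_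
    rw [aux_delta]
    split_ifs <;> simp
  · simpa [aux_delta] using aux_norm_le (delta k) k

lemma aux_full (u : CZero) : ⨆ j : ℕ, ‖u j‖ ^ 2 = ‖u‖ ^ 2 := by
  have hb : BddAbove (Set.range fun j => ‖u j‖ ^ 2) := by
    refine ⟨‖u‖ ^ 2, ?_⟩
    rintro _ ⟨j, rfl⟩
    exact aux_norm_sq_le u _
  apply le_antisymm
  · exact ciSup_le fun j => aux_norm_sq_le u j
  · have hn : 0 ≤ ⨆ j, ‖u j‖ ^ 2 := Real.iSup_nonneg fun j => by positivity
    have : ‖u‖ ≤ √(⨆ j, ‖u j‖ ^ 2) :=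
      aux_czero_norm_le u (Real.sqrt_nonneg _) fun i => Real.le_sqrt_of_sq_le (le_ciSup hb i)
    exact (Real.le_sqrt (norm_nonneg _) hn).1 this

/-- For every `ℓ ∈ ℕ`, the family `{δ j}_{j ≠ ℓ}` is not a frame for `c₀`:
`‖∑_{j ≠ ℓ} ⟪u, δⱼ⟫⟪δⱼ, u⟫‖ = sup_{j ≠ ℓ} |uⱼ|²` and no lower frame bound `C > 0` exists
(for `u = δ ℓ` the right-hand side is `0` while `‖δ ℓ‖ = 1`). Consequently `{δ j}` is an
exact frame for `c₀`. -/
theorem delta_exact_frame :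
    (∀ ℓ : ℕ, ∀ u : CZero,
      ‖∑' j : {j : ℕ // j ≠ ℓ}, cInner u (delta j) * cInner (delta j) u‖
        = ⨆ j : {j : ℕ // j ≠ ℓ}, ‖u j‖ ^ 2) ∧
    (∀ ℓ : ℕ,
      ‖∑' j : {j : ℕ // j ≠ ℓ}, cInner (delta ℓ) (delta j) * cInner (delta j) (delta ℓ)‖ = 0 ∧
      ‖delta ℓ‖ = 1) ∧
    (∀ ℓ : ℕ, ¬ ∃ C : ℝ, 0 < C ∧ ∀ u : CZero,
      C * ‖u‖ ^ 2 ≤ ‖∑' j : {j : ℕ // j ≠ ℓ}, cInner u (delta j) * cInner (delta j) u‖) ∧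
    (IsFrameC0 (fun j : ℕ => delta j) ∧
      ∀ ℓ : ℕ, ¬ IsFrameC0 (fun j : {j : ℕ // j ≠ ℓ} => delta j)) := by
  have h1 : ∀ ℓ : ℕ, ∀ u : CZero,
      ‖∑' j : {j : ℕ // j ≠ ℓ}, cInner u (delta j) * cInner (delta j) u‖
        = ⨆ j : {j : ℕ // j ≠ ℓ}, ‖u j‖ ^ 2 := fun ℓ u =>
    aux_main (fun j : {j : ℕ // j ≠ ℓ} => (j : ℕ)) Subtype.val_injective u
  have h2 : ∀ ℓ : ℕ,
      ‖∑' j : {j : ℕ // j ≠ ℓ}, cInner (delta ℓ) (delta j) * cInner (delta j) (delta ℓ)‖ = 0 := by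
    intro ℓ
    rw [h1]
    have : ∀ j : {j : ℕ // j ≠ ℓ}, ‖delta ℓ j‖ ^ 2 = 0 := fun j => by
      rw [aux_delta, if_neg j.2]; simp
    simp_rw [this]
    exact Real.iSup_const_zero
  have h3 : ∀ ℓ : ℕ, ¬ ∃ C : ℝ, 0 < C ∧ ∀ u : CZero,
      C * ‖u‖ ^ 2 ≤ ‖∑' j : {j : ℕ // j ≠ ℓ}, cInner u (delta j) * cInner (delta j) u‖ := by
    rintro ℓ ⟨C, hC, h⟩
    have := h (delta ℓ)
    rw [h2, aux_delta_norm] at this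
    linarith
  refine ⟨h1, fun ℓ => ⟨h2 ℓ, aux_delta_norm ℓ⟩, h3, ⟨fun u => ?_, 1, 1, one_pos, le_rfl, fun u => ?_⟩,
    ?_⟩
  · exact (aux_hasSum id Function.injective_id u).summable
  · have := (aux_main id Function.injective_id u).trans (aux_full u)
    simp only [id] at this
    rw [this, one_mul]
    exact ⟨le_rfl, le_rfl⟩
  · rintro ℓ ⟨_, C, D, hC, _, h⟩
    exact h3 ℓ ⟨C, hC, fun u => (h u).1⟩

end
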